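/- arXiv:1103.3904 — 6 statements merged into one kernel-verified Lean document; each statement's English description precedes it below -/
import Mathlib

section
/- For every Hamiltonian cycle H on V and every vertex v ∈ V, if T is a spanning tree of the complete graph on V \ {v} of minimum total weight with respect to w, then the weight of T is at most the sum of the weights of the edges of H not incident with v. -/
open SimpleGraph Finset

variable {V : Type} [Fintype V] [DecidableEq V]

/-- `S` is the edge set of a spanning tree of the complete graph on `V \ {v}`:
the edges of a tree on the subtype `{u // u ≠ v}`, viewed inside `Sym2 V`. -/
def IsSpanningTreeOff (v : V) (S : Finset (Sym2 V)) : Prop :=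
  ∃ T : SimpleGraph {u : V // u ≠ v}, T.IsTree ∧
    (S : Set (Sym2 V)) = Sym2.map Subtype.val '' T.edgeSet

/-- `T` is (the edge set of) a 1-tree rooted at `v`: a spanning tree of the complete
graph on `V \ {v}` together with two distinct (non-loop) edges incident with `v`. -/
def IsOneTree (v : V) (T : Finset (Sym2 V)) : Prop :=
  ∃ (S : Finset (Sym2 V)) (e₁ e₂ : Sym2 V),
    IsSpanningTreeOff v S ∧ e₁ ≠ e₂ ∧ v ∈ e₁ ∧ v ∈ e₂ ∧
    ¬ e₁.IsDiag ∧ ¬ e₂.IsDiag ∧ T = S ∪ {e₁, e₂}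

/-- The total weight of an edge set. -/
noncomputable def weight (w : Sym2 V → ℝ) (T : Finset (Sym2 V)) : ℝ := ∑ e ∈ T, w e

/-- The edges of a Hamiltonian path form a tree. -/
theorem SimpleGraph.Walk.IsHamiltonian.isTree_fromEdgeSet {W : Type*} [Fintype W] [DecidableEq W]
    {G : SimpleGraph W} {a b : W} {p : G.Walk a b} (hp : p.IsHamiltonian) :
    (fromEdgeSet {e | e ∈ p.edges}).IsTree ∧
      (fromEdgeSet {e | e ∈ p.edges}).edgeSet = {e | e ∈ p.edges} := by
  have hedge : (fromEdgeSet {e | e ∈ p.edges}).edgeSet = {e | e ∈ p.edges} := by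
    rw [edgeSet_fromEdgeSet, sdiff_eq_left, Set.disjoint_left]
    exact fun e he hd => G.not_isDiag_of_mem_edgeSet (p.edges_subset_edgeSet he) hd
  refine ⟨isTree_iff_connected_and_card.2 ⟨?_, ?_⟩, hedge⟩
  · rw [connected_iff_exists_forall_reachable]
    refine ⟨a, fun w => ?_⟩
    let q := p.transfer (fromEdgeSet {e | e ∈ p.edges}) fun e he => by rw [hedge]; exact he
    have hw : w ∈ q.support := by rw [Walk.support_transfer]; exact hp.mem_support w
    exact (q.takeUntil w hw).reachable
  · have hset : {e | e ∈ p.edges} = (p.edges.toFinset : Set (Sym2 W)) := by ext; simp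
    rw [hedge, hset, Nat.card_coe_set_eq, Set.ncard_coe_finset,
      List.toFinset_card_of_nodup hp.isPath.isTrail.edges_nodup, Walk.length_edges,
      Nat.card_eq_fintype_card, ← hp.length_support, Walk.length_support]

/-- A path visiting exactly the vertices other than `v` spans `V \ {v}`. -/
theorem SimpleGraph.Walk.IsPath.isSpanningTreeOff {V : Type} [Fintype V] [DecidableEq V]
    {G : SimpleGraph V} {a b : V} {p : G.Walk a b} (hp : p.IsPath) {v : V}
    (hsupp : ∀ x, x ∈ p.support ↔ x ≠ v) : IsSpanningTreeOff v p.edges.toFinset := by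
  let f := (Embedding.induce (G := G) {u | u ≠ v}).toHom
  let q := p.induce {u | u ≠ v} fun x hx => (hsupp x).1 hx
  have hmap : q.map f = p := p.map_induce _
  have hq : q.IsPath := Walk.IsPath.of_map (f := f) (by rwa [hmap])
  have hqH : q.IsHamiltonian := hq.isHamiltonian_of_mem fun x => by
    have hx : (x : V) ∈ (q.map f).support := by
      rw [hmap]; exact (hsupp x).2 x.2
    rw [Walk.support_map, List.mem_map] at hx
    obtain ⟨y, hy, hyx⟩ := hx
    exact Subtype.ext hyx ▸ hy
  refine ⟨_, hqH.isTree_fromEdgeSet.1, ?_⟩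
  refine Eq.trans ?_ (congrArg (Sym2.map Subtype.val '' ·) hqH.isTree_fromEdgeSet.2.symm)
  have hedges : p.edges = q.edges.map (Sym2.map f) :=
    (congrArg Walk.edges hmap).symm.trans (Walk.edges_map f q)
  ext e
  simp only [hedges, List.coe_toFinset, List.mem_map, Set.mem_ofPred_eq, Set.mem_image]
  rfl

/-- Deleting a vertex from a Hamiltonian cycle leaves a spanning tree of the remaining vertices. -/
theorem SimpleGraph.Walk.IsHamiltonianCycle.isSpanningTreeOff {V : Type} [Fintype V]
    [DecidableEq V] {G : SimpleGraph V} {r : V} {H : G.Walk r r} (hH : H.IsHamiltonianCycle)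
    (v : V) : IsSpanningTreeOff v (H.edges.toFinset.filter (fun e => v ∉ e)) := by
  have hv : v ∈ H.support := hH.mem_support v
  have hC := hH.rotate hv
  have hedges : (H.rotate v hv).edges.toFinset = H.edges.toFinset :=
    List.toFinset_eq_of_perm _ _ (H.rotate_edges v hv).perm
  rw [← hedges]
  generalize H.rotate v hv = C at hC
  cases C with
  | nil => exact (hC.isCycle.not_nil .nil).elim
  | cons h q =>
    have hq : q.reverse.IsHamiltonian := by
      have hpath : q.IsPath := by simpa using hC.isHamiltonian_tail.isPath
      exact hpath.reverse.isHamiltonian_of_mem fun x => by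
        simpa using hC.isHamiltonian_tail.mem_support x
    have hqe : q.edges.toFinset = q.reverse.edges.toFinset := by simp
    rw [Walk.edges_cons, List.toFinset_cons, hqe]
    generalize q.reverse = q' at hq
    cases q' with
    | nil => exact (G.irrefl h).elim
    | cons h' p =>
      have hp := Walk.cons_isPath_iff h' p |>.1 hq.isPath
      convert hp.1.isSpanningTreeOff (v := v) ?_ using 1
      · ext e
        have hpe : e ∈ p.edges → v ∉ e := fun he hve =>
          hp.2 (p.mem_support_of_mem_edges he hve)
        simp only [Walk.edges_cons, List.toFinset_cons, Finset.mem_filter, Finset.mem_insert,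
          List.mem_toFinset]
        constructor
        · rintro ⟨rfl | rfl | he, hve⟩
          · simp at hve
          · simp at hve
          · exact he
        · exact fun he => ⟨.inr (.inr he), hpe he⟩
      · intro x
        refine ⟨fun hx hxv => hp.2 (hxv ▸ hx), fun hxv => ?_⟩
        simpa [hxv] using hq.mem_support x

theorem stmt2 {V : Type} [Fintype V] [DecidableEq V] (h3 : 3 ≤ Fintype.card V)
    (w : Sym2 V → ℝ)
    (r : V) (H : (⊤ : SimpleGraph V).Walk r r) (hH : H.IsHamiltonianCycle) (v : V)
    (T : Finset (Sym2 V)) (hT : IsSpanningTreeOff v T)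
    (hmin : ∀ T' : Finset (Sym2 V), IsSpanningTreeOff v T' → weight w T ≤ weight w T') :
    weight w T ≤ weight w (H.edges.toFinset.filter (fun e => v ∉ e)) := by
  exact hmin _ (hH.isSpanningTreeOff v)
end

section
/- Let I and X be disjoint sets of edges of the complete graph on V, let H be a Hamiltonian cycle on V whose edge set contains every edge of I and no edge of X, and let v ∈ V. Let I_v denote the set of edges of I incident with v. Then the minimum of w(e₁) + w(e₂) over all pairs {e₁, e₂} of distinct edges incident with v satisfying I_v ⊆ {e₁, e₂} and {e₁, e₂} ∩ X = ∅ is at most the sum of the weights of the two edges of H incident with v. -/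
open SimpleGraph Finset

variable {V : Type} [Fintype V] [DecidableEq V]

/-- The edges of a Hamiltonian cycle incident with a vertex are two distinct edges. -/
theorem SimpleGraph.Walk.IsHamiltonianCycle.exists_filter_edges_eq_pair
    {V : Type*} [DecidableEq V] {G : SimpleGraph V} {r : V} {H : G.Walk r r}
    (hH : H.IsHamiltonianCycle) (v : V) :
    ∃ e₁ e₂ : Sym2 V, e₁ ≠ e₂ ∧ H.edges.toFinset.filter (fun e => v ∈ e) = {e₁, e₂} := by
  obtain ⟨a, b, hab, hN⟩ := Set.ncard_eq_two.mp
    (hH.isCycle.ncard_neighborSet_toSubgraph_eq_two (hH.mem_support v))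
  have hadj (u : V) : s(v, u) ∈ H.edges ↔ u = a ∨ u = b := by
    rw [← Walk.adj_toSubgraph_iff_mem_edges, ← Subgraph.mem_neighborSet, hN]
    simp
  refine ⟨s(v, a), s(v, b), fun h => hab (Sym2.congr_right.mp h), ?_⟩
  ext e
  simp only [Finset.mem_filter, List.mem_toFinset, Finset.mem_insert, Finset.mem_singleton]
  constructor
  · rintro ⟨he, u, rfl⟩
    exact ((hadj u).mp he).imp (congrArg (s(v, ·))) (congrArg (s(v, ·)))
  · rintro (rfl | rfl)
    · exact ⟨(hadj a).mpr (.inl rfl), Sym2.mem_mk_left v a⟩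
    · exact ⟨(hadj b).mpr (.inr rfl), Sym2.mem_mk_left v b⟩

theorem stmt4 {V : Type} [Fintype V] [DecidableEq V] (h3 : 3 ≤ Fintype.card V)
    (w : Sym2 V → ℝ) (I X : Finset (Sym2 V))
    (hIedge : (I : Set (Sym2 V)) ⊆ (⊤ : SimpleGraph V).edgeSet)
    (hXedge : (X : Set (Sym2 V)) ⊆ (⊤ : SimpleGraph V).edgeSet)
    (hIX : Disjoint I X)
    (r : V) (H : (⊤ : SimpleGraph V).Walk r r) (hH : H.IsHamiltonianCycle)
    (hIH : I ⊆ H.edges.toFinset) (hXH : ∀ e ∈ X, e ∉ H.edges.toFinset) (v : V) :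
    sInf {x : ℝ | ∃ e₁ e₂ : Sym2 V, e₁ ≠ e₂ ∧ v ∈ e₁ ∧ v ∈ e₂ ∧
        ¬ e₁.IsDiag ∧ ¬ e₂.IsDiag ∧
        (∀ e ∈ I, v ∈ e → e = e₁ ∨ e = e₂) ∧ e₁ ∉ X ∧ e₂ ∉ X ∧ w e₁ + w e₂ = x}
      ≤ weight w (H.edges.toFinset.filter (fun e => v ∈ e)) := by
  obtain ⟨e₁, e₂, hne, hpair⟩ := hH.exists_filter_edges_eq_pair v
  have hmem (e : Sym2 V) : (e ∈ H.edges.toFinset ∧ v ∈ e) ↔ e = e₁ ∨ e = e₂ := by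
    simpa using Finset.ext_iff.mp hpair e
  obtain ⟨he₁, hv₁⟩ := (hmem e₁).mpr (.inl rfl)
  obtain ⟨he₂, hv₂⟩ := (hmem e₂).mpr (.inr rfl)
  have hdiag (e : Sym2 V) (he : e ∈ H.edges.toFinset) : ¬ e.IsDiag :=
    SimpleGraph.not_isDiag_of_mem_edgeSet _ (H.edges_subset_edgeSet (List.mem_toFinset.mp he))
  rw [hpair, weight, Finset.sum_pair hne]
  refine csInf_le ?_ ⟨e₁, e₂, hne, hv₁, hv₂, hdiag e₁ he₁, hdiag e₂ he₂,
    fun e he hv => (hmem e).mp ⟨hIH he, hv⟩, fun h => hXH e₁ h he₁, fun h => hXH e₂ h he₂, rfl⟩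
  refine ((Set.finite_range fun p : Sym2 V × Sym2 V => w p.1 + w p.2).subset ?_).bddBelow
  rintro x ⟨f₁, f₂, -, -, -, -, -, -, -, -, rfl⟩
  exact ⟨(f₁, f₂), rfl⟩
end

section
/- Let I and X be disjoint sets of edges of the complete graph on V, let H be a Hamiltonian cycle on V whose edge set contains every edge of I and no edge of X, and let v ∈ V. Then the minimum weight over all 1-trees rooted at v whose edge set contains every edge of I and no edge of X is at most the weight of H. (In other words, the weight of a minimum constrained 1-tree is a lower bound on the weight of every Hamiltonian cycle satisfying the same inclusion and exclusion constraints.) -/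
open SimpleGraph Finset

variable {V : Type} [Fintype V] [DecidableEq V]

/-- The edges of a Hamiltonian path form a spanning tree. -/
lemma isTree_fromEdgeSet_of_isHamiltonian {G : SimpleGraph V} {a b : V}
    {p : G.Walk a b} (hp : p.IsHamiltonian) : (fromEdgeSet {e | e ∈ p.edges}).IsTree := by
  have hE : (fromEdgeSet {e | e ∈ p.edges}).edgeSet = (p.edges.toFinset : Set (Sym2 V)) := by
    ext e
    simp only [edgeSet_fromEdgeSet, List.coe_toFinset, Set.mem_sdiff]
    exact ⟨And.left, fun h ↦ ⟨h, G.not_isDiag_of_mem_edgeSet (p.edges_subset_edgeSet h)⟩⟩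
  rw [isTree_iff_connected_and_card]
  constructor
  · have ht : ∀ e ∈ p.edges, e ∈ (fromEdgeSet {e | e ∈ p.edges}).edgeSet := by
      intro e he
      rw [hE]
      simpa using he
    have hr : ∀ x, (fromEdgeSet {e | e ∈ p.edges}).Reachable a x := fun x ↦
      ⟨(p.transfer _ ht).takeUntil x (by simp [hp.mem_support])⟩
    have : Nonempty V := ⟨a⟩
    exact ⟨fun x y ↦ (hr x).symm.trans (hr y)⟩
  · have : 0 < Fintype.card V := Fintype.card_pos_iff.mpr ⟨a⟩
    rw [hE, Nat.card_eq_card_toFinset, Finset.toFinset_coe,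
      List.toFinset_card_of_nodup hp.isPath.isTrail.edges_nodup, Walk.length_edges,
      hp.length_eq, Nat.card_eq_fintype_card]
    omega

/-- The edges of a path visiting exactly the vertices other than `v` form a spanning tree
of the complete graph on those vertices. -/
lemma isSpanningTreeOff_of_isPath {G : SimpleGraph V} {v a b : V} {p : G.Walk a b}
    (hp : p.IsPath) (hmem : ∀ x, x ∈ p.support ↔ x ≠ v) :
    IsSpanningTreeOff v p.edges.toFinset := by
  let q := p.induce {u | u ≠ v} fun x hx ↦ (hmem x).mp hx
  have hmap : q.map (Embedding.induce _).toHom = p := p.map_induce _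
  have hq : q.IsHamiltonian := by
    refine Walk.IsPath.isHamiltonian_of_mem (Walk.IsPath.of_map (hmap.symm ▸ hp)) fun x ↦ ?_
    simpa [q] using (hmem x).mpr x.2
  refine ⟨_, isTree_fromEdgeSet_of_isHamiltonian hq, ?_⟩
  have hE : p.edges = q.edges.map (Sym2.map Subtype.val) := by
    exact (congrArg Walk.edges hmap).symm.trans (Walk.edges_map _ q)
  ext e
  rw [hE]
  simp only [List.coe_toFinset, List.mem_map, Set.mem_ofPred_eq, Set.mem_image,
    edgeSet_fromEdgeSet, Set.mem_sdiff]
  exact exists_congr fun d ↦ and_congr_left' ⟨fun h ↦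
    ⟨h, not_isDiag_of_mem_edgeSet _ (q.edges_subset_edgeSet h)⟩, And.left⟩

/-- The edge set of a Hamiltonian cycle is a 1-tree rooted at any of its vertices. -/
lemma isOneTree_edges_of_isHamiltonianCycle {G : SimpleGraph V} {r : V} {H : G.Walk r r}
    (hH : H.IsHamiltonianCycle) (v : V) : IsOneTree v H.edges.toFinset := by
  have hv := hH.mem_support v
  have hC := hH.rotate hv
  rw [← List.toFinset_eq_of_perm _ _ (H.rotate_edges v hv).perm]
  generalize H.rotate v hv = C at hC
  cases C with
  | nil => exact absurd rfl hC.ne_nil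
  | cons h p =>
    obtain ⟨hp, hvp⟩ := (Walk.cons_isCycle_iff _ _).mp hC.isCycle
    have hsupp := hC.mem_support
    cases p with
    | nil => exact absurd rfl h.ne
    | cons h₁ p₁ =>
      obtain ⟨x, q, h₂, hq⟩ := Walk.exists_cons_eq_concat h₁ p₁
      rw [hq] at hp hvp hsupp ⊢
      rw [Walk.isPath_def, Walk.support_concat, ← List.concat_eq_append,
        List.nodup_concat] at hp
      refine ⟨q.edges.toFinset, s(v, _), s(x, v),
        isSpanningTreeOff_of_isPath ((Walk.isPath_def _).mpr hp.2) fun y ↦ ⟨?_, fun hy ↦ ?_⟩,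
        ?_, by simp, by simp, by simpa using h.ne, by simpa using h₂.ne, ?_⟩
      · rintro hy rfl
        exact hp.1 hy
      · simpa [Walk.support_concat, hy] using hsupp y
      · intro heq
        exact hvp (by simp [Walk.edges_concat, heq])
      · ext e
        simp only [Walk.edges_cons, Walk.edges_concat, List.mem_toFinset, List.mem_cons,
          List.concat_eq_append, List.mem_append, List.not_mem_nil, Finset.mem_union,
          Finset.mem_insert, Finset.mem_singleton]
        tauto

theorem stmt5 {V : Type} [Fintype V] [DecidableEq V] (h3 : 3 ≤ Fintype.card V)
    (w : Sym2 V → ℝ) (I X : Finset (Sym2 V))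
    (hIedge : (I : Set (Sym2 V)) ⊆ (⊤ : SimpleGraph V).edgeSet)
    (hXedge : (X : Set (Sym2 V)) ⊆ (⊤ : SimpleGraph V).edgeSet)
    (hIX : Disjoint I X)
    (r : V) (H : (⊤ : SimpleGraph V).Walk r r) (hH : H.IsHamiltonianCycle)
    (hIH : I ⊆ H.edges.toFinset) (hXH : ∀ e ∈ X, e ∉ H.edges.toFinset) (v : V) :
    sInf {x : ℝ | ∃ T : Finset (Sym2 V), IsOneTree v T ∧ I ⊆ T ∧
        (∀ e ∈ X, e ∉ T) ∧ weight w T = x}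
      ≤ weight w H.edges.toFinset := by
  refine csInf_le ?_ ⟨H.edges.toFinset, isOneTree_edges_of_isHamiltonianCycle hH v, hIH, hXH, rfl⟩
  refine ((Set.finite_range (weight w)).subset ?_).bddBelow
  rintro x ⟨T, -, -, -, rfl⟩
  exact Set.mem_range_self T
end

section
/- For every vertex v ∈ V, the minimum weight over all 1-trees rooted at v is at most the minimum weight over all Hamiltonian cycles on V; that is, the minimum 1-tree weight is a lower bound on the optimal travelling-salesman tour length. -/
open SimpleGraph Finset

variable {V : Type} [Fintype V] [DecidableEq V]

/-- The edges of a Hamiltonian path form a spanning tree. -/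
lemma SimpleGraph.Walk.IsHamiltonian.isTree_fromEdgeSet_edges {α : Type*} [DecidableEq α]
    {G : SimpleGraph α} {a b : α} {p : G.Walk a b} (hp : p.IsHamiltonian) :
    (fromEdgeSet {e | e ∈ p.edges}).IsTree ∧
      (fromEdgeSet {e | e ∈ p.edges}).edgeSet = {e | e ∈ p.edges} := by
  have : Fintype α := hp.fintype
  have hE : (fromEdgeSet {e | e ∈ p.edges}).edgeSet = {e | e ∈ p.edges} := by
    rw [edgeSet_fromEdgeSet, sdiff_eq_left, Set.disjoint_left]
    exact fun e he hd ↦ G.not_isDiag_of_mem_edgeSet (p.edges_subset_edgeSet he) hd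
  refine ⟨isTree_iff_connected_and_card.mpr ⟨?_, ?_⟩, hE⟩
  · let q := p.transfer (fromEdgeSet {e | e ∈ p.edges}) fun e he ↦ by rwa [hE]
    have hq (c : α) : c ∈ q.support := by
      simpa [q] using hp.mem_support c
    have : Nonempty α := ⟨a⟩
    exact ⟨fun c d ↦ ((q.takeUntil c (hq c)).reverse.append (q.takeUntil d (hq d))).reachable⟩
  · have hcard : Nat.card {e | e ∈ p.edges} = p.length := by
      rw [← p.length_edges, ← List.toFinset_card_of_nodup hp.isPath.edges_nodup,
        ← Set.ncard_coe_finset, List.coe_toFinset, Nat.card_coe_set_eq]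
    have : Nonempty α := ⟨a⟩
    rw [hE, hcard, hp.length_eq, Nat.card_eq_fintype_card,
      Nat.sub_add_cancel Fintype.card_pos]

/-- A path that visits exactly the vertices different from `v` is a spanning tree off `v`. -/
lemma SimpleGraph.Walk.IsPath.isSpanningTreeOff_edges {α : Type} [DecidableEq α]
    {G : SimpleGraph α} {a b v : α} {p : G.Walk a b} (hp : p.IsPath)
    (hv : ∀ u, u ∈ p.support ↔ u ≠ v) : IsSpanningTreeOff v p.edges.toFinset := by
  let q := p.induce {u | u ≠ v} fun u hu ↦ (hv u).mp hu
  have hqp : q.map (Embedding.induce {u | u ≠ v}).toHom = p := p.map_induce _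
  have hq : q.IsHamiltonian := by
    refine IsPath.isHamiltonian_of_mem (.of_map (f := (Embedding.induce _).toHom) ?_) fun u ↦ ?_
    · rwa [hqp]
    · simpa [q] using (hv u).mpr u.2
  obtain ⟨htree, hedges⟩ := hq.isTree_fromEdgeSet_edges
  refine ⟨_, htree, ?_⟩
  refine Eq.trans ?_ (congrArg (Sym2.map Subtype.val '' ·) hedges).symm
  have hpq : p.edges = q.edges.map (Sym2.map Subtype.val) :=
    (congrArg Walk.edges hqp).symm.trans (Walk.edges_map _ _)
  ext e
  simp only [hpq, List.coe_toFinset, List.mem_map]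
  rfl

/-- The edges of a Hamiltonian cycle form a 1-tree rooted at any vertex. -/
lemma SimpleGraph.Walk.IsHamiltonianCycle.isOneTree {α : Type} [DecidableEq α]
    {G : SimpleGraph α} {r : α} {H : G.Walk r r} (hH : H.IsHamiltonianCycle) (v : α) :
    IsOneTree v H.edges.toFinset := by
  wlog hr : r = v generalizing r
  · have hv := hH.mem_support v
    rw [← List.toFinset_eq_of_perm _ _ (H.rotate_edges v hv).perm]
    exact this (hH.rotate hv) rfl
  subst hr
  have hcyc := hH.isCycle
  have hham := (isHamiltonianCycle_iff_isCycle_and_support_count_tail_eq_one.mp hH).2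
  have hlen := hcyc.three_le_length
  cases H with
  | nil => simp at hlen
  | @cons _ u _ h p =>
    rw [Walk.cons_isCycle_iff] at hcyc
    replace hham : p.IsHamiltonian := hham
    have hpr : p.edges = p.reverse.edges.reverse := by simp
    have hrham : ∀ c, c ∈ p.reverse.support := by simp [hham.mem_support]
    have hrpath := hcyc.1.reverse
    have hru := hcyc.2
    rw [Walk.edges_cons, hpr]
    rw [hpr, List.mem_reverse] at hru
    generalize p.reverse = s at *
    cases s with
    | nil => exact absurd rfl h.ne
    | @cons _ u' _ h' q =>
      rw [Walk.cons_isPath_iff] at hrpath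
      rw [Walk.edges_cons, List.mem_cons, not_or] at hru
      refine ⟨q.edges.toFinset, s(r, u), s(r, u'), ?_, hru.1, by simp, by simp, by simpa using h.ne,
        by simpa using h'.ne, ?_⟩
      · refine hrpath.1.isSpanningTreeOff_edges fun c ↦ ⟨?_, fun hc ↦ ?_⟩
        · rintro hc rfl
          exact hrpath.2 hc
        · simpa [hc] using hrham c
      · ext e
        simp

/-- The complete graph on at least three vertices has a Hamiltonian cycle. -/
lemma SimpleGraph.exists_isHamiltonianCycle_top {α : Type*} [Fintype α] [DecidableEq α]
    (h3 : 3 ≤ Fintype.card α) :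
    ∃ (r : α) (H : (⊤ : SimpleGraph α).Walk r r), H.IsHamiltonianCycle := by
  obtain ⟨n, hn⟩ := Nat.exists_eq_add_of_le' h3
  let e : Fin (n + 3) ≃ α := (Fintype.equivFinOfCardEq hn).symm
  let f : cycleGraph (n + 3) →g (⊤ : SimpleGraph α) := ⟨e, fun h ↦ by simpa using h.ne⟩
  have hc : (cycleGraph.cycle n).IsHamiltonianCycle :=
    Walk.isHamiltonianCycle_iff_isCycle_and_length_eq.mpr
      ⟨cycleGraph.isCycle_cycle, by simp [cycleGraph.length_cycle]⟩
  exact ⟨_, _, hc.map (f := f) e.bijective⟩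

theorem stmt6 {V : Type} [Fintype V] [DecidableEq V] (h3 : 3 ≤ Fintype.card V)
    (w : Sym2 V → ℝ) (v : V) :
    sInf {x : ℝ | ∃ T : Finset (Sym2 V), IsOneTree v T ∧ weight w T = x}
      ≤ sInf {x : ℝ | ∃ (r : V) (H : (⊤ : SimpleGraph V).Walk r r),
          H.IsHamiltonianCycle ∧ weight w H.edges.toFinset = x} := by
  refine csInf_le_csInf ?_ ?_ ?_
  · exact ((Set.toFinite {T | IsOneTree v T}).image (weight w)).bddBelow
  · obtain ⟨r, H, hH⟩ := exists_isHamiltonianCycle_top h3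
    exact ⟨_, r, H, hH, rfl⟩
  · rintro _ ⟨r, H, hH, rfl⟩
    exact ⟨_, hH.isOneTree v, rfl⟩
end

section
/- Let I and X be disjoint sets of edges of the complete graph on V and let v ∈ V. Suppose at most two edges of I are incident with v, there exists a spanning tree of the complete graph on V \ {v} containing every edge of I not incident with v and no edge of X, and there exists a pair {e₁, e₂} of distinct edges incident with v containing every edge of I incident with v and no edge of X. Then the minimum weight over 1-trees rooted at v whose edge set contains every edge of I and no edge of X equals the minimum weight of a spanning tree of V \ {v} subject to those constraints plus the minimum of w(e₁) + w(e₂) over such pairs at v. -/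
open SimpleGraph Finset

variable {V : Type} [Fintype V] [DecidableEq V]

open scoped Pointwise

theorem IsSpanningTreeOff.notMem_of_mem {V : Type} {v : V} {S : Finset (Sym2 V)}
    (hS : IsSpanningTreeOff v S) {e : Sym2 V} (he : e ∈ S) : v ∉ e := by
  obtain ⟨T, -, hST⟩ := hS
  have he' : e ∈ (S : Set (Sym2 V)) := he
  rw [hST] at he'
  obtain ⟨a, -, rfl⟩ := he'
  rw [Sym2.mem_map]
  rintro ⟨u, -, hu⟩
  exact u.2 hu

theorem weight_union_pair {V : Type} [DecidableEq V] (w : Sym2 V → ℝ) {v : V}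
    {S : Finset (Sym2 V)} (hS : IsSpanningTreeOff v S) {e₁ e₂ : Sym2 V} (hne : e₁ ≠ e₂)
    (h₁ : v ∈ e₁) (h₂ : v ∈ e₂) :
    weight w (S ∪ {e₁, e₂}) = weight w S + (w e₁ + w e₂) := by
  unfold weight
  rw [Finset.sum_union, Finset.sum_pair hne]
  rw [Finset.disjoint_right]
  intro e he heS
  have := hS.notMem_of_mem heS
  simp only [Finset.mem_insert, Finset.mem_singleton] at he
  rcases he with rfl | rfl <;> contradiction

theorem stmt12 {V : Type} [Fintype V] [DecidableEq V] (h3 : 3 ≤ Fintype.card V)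
    (w : Sym2 V → ℝ) (I X : Finset (Sym2 V))
    (hIedge : (I : Set (Sym2 V)) ⊆ (⊤ : SimpleGraph V).edgeSet)
    (hXedge : (X : Set (Sym2 V)) ⊆ (⊤ : SimpleGraph V).edgeSet)
    (hIX : Disjoint I X) (v : V)
    (hcard : (I.filter (fun e => v ∈ e)).card ≤ 2)
    (hST : ∃ S : Finset (Sym2 V), IsSpanningTreeOff v S ∧
      (∀ e ∈ I, v ∉ e → e ∈ S) ∧ ∀ e ∈ X, e ∉ S)
    (hpair : ∃ e₁ e₂ : Sym2 V, e₁ ≠ e₂ ∧ v ∈ e₁ ∧ v ∈ e₂ ∧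
      ¬ e₁.IsDiag ∧ ¬ e₂.IsDiag ∧
      (∀ e ∈ I, v ∈ e → e = e₁ ∨ e = e₂) ∧ e₁ ∉ X ∧ e₂ ∉ X) :
    sInf {x : ℝ | ∃ T : Finset (Sym2 V), IsOneTree v T ∧ I ⊆ T ∧
        (∀ e ∈ X, e ∉ T) ∧ weight w T = x} =
    sInf {x : ℝ | ∃ S : Finset (Sym2 V), IsSpanningTreeOff v S ∧
        (∀ e ∈ I, v ∉ e → e ∈ S) ∧ (∀ e ∈ X, e ∉ S) ∧ weight w S = x} +
    sInf {x : ℝ | ∃ e₁ e₂ : Sym2 V, e₁ ≠ e₂ ∧ v ∈ e₁ ∧ v ∈ e₂ ∧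
        ¬ e₁.IsDiag ∧ ¬ e₂.IsDiag ∧
        (∀ e ∈ I, v ∈ e → e = e₁ ∨ e = e₂) ∧ e₁ ∉ X ∧ e₂ ∉ X ∧ w e₁ + w e₂ = x} := by
  rw [← csInf_add]
  · congr 1
    ext x
    rw [Set.mem_add]
    constructor
    · rintro ⟨T, ⟨S, e₁, e₂, hS, hne, h₁, h₂, hd₁, hd₂, rfl⟩, hI, hX, rfl⟩
      refine ⟨_, ⟨S, hS, ?_, ?_, rfl⟩, _,
        ⟨e₁, e₂, hne, h₁, h₂, hd₁, hd₂, ?_, ?_, ?_, rfl⟩,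
        (weight_union_pair w hS hne h₁ h₂).symm⟩
      · intro e he hv
        have := hI he
        simp only [Finset.mem_union, Finset.mem_insert, Finset.mem_singleton] at this
        rcases this with h | rfl | rfl
        · exact h
        · exact absurd h₁ hv
        · exact absurd h₂ hv
      · exact fun e he heS => hX e he (Finset.mem_union_left _ heS)
      · intro e he hv
        have := hI he
        simp only [Finset.mem_union, Finset.mem_insert, Finset.mem_singleton] at this
        exact this.resolve_left fun h => hS.notMem_of_mem h hv
      · exact fun h => hX _ h (by simp)
      · exact fun h => hX _ h (by simp)
    · rintro ⟨_, ⟨S, hS, hSI, hSX, rfl⟩, _,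
        ⟨e₁, e₂, hne, h₁, h₂, hd₁, hd₂, hI, hX₁, hX₂, rfl⟩, rfl⟩
      refine ⟨S ∪ {e₁, e₂}, ⟨S, e₁, e₂, hS, hne, h₁, h₂, hd₁, hd₂, rfl⟩, ?_, ?_,
        weight_union_pair w hS hne h₁ h₂⟩
      · intro e he
        simp only [Finset.mem_union, Finset.mem_insert, Finset.mem_singleton]
        by_cases hv : v ∈ e
        · exact Or.inr (hI e he hv)
        · exact Or.inl (hSI e he hv)
      · intro e he heT
        simp only [Finset.mem_union, Finset.mem_insert, Finset.mem_singleton] at heT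
        rcases heT with h | rfl | rfl
        · exact hSX e he h
        · exact hX₁ he
        · exact hX₂ he
  · obtain ⟨S, hS, hSI, hSX⟩ := hST
    exact ⟨_, S, hS, hSI, hSX, rfl⟩
  · refine ((Set.finite_range (weight w)).subset ?_).bddBelow
    rintro _ ⟨S, -, -, -, rfl⟩
    exact ⟨S, rfl⟩
  · obtain ⟨e₁, e₂, hne, h₁, h₂, hd₁, hd₂, hI, hX₁, hX₂⟩ := hpair
    exact ⟨_, e₁, e₂, hne, h₁, h₂, hd₁, hd₂, hI, hX₁, hX₂, rfl⟩
  · refine ((Set.finite_range fun p : Sym2 V × Sym2 V => w p.1 + w p.2).subset ?_).bddBelow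
    rintro _ ⟨e₁, e₂, -, -, -, -, -, -, -, -, rfl⟩
    exact ⟨(e₁, e₂), rfl⟩
end

section
/- Let I and X be disjoint sets of edges of the complete graph on V and let H be a Hamiltonian cycle on V whose edge set contains every edge of I and no edge of X. Then for every vertex v ∈ V, the set of edges of H not incident with v is the edge set of a spanning tree of the complete graph on V \ {v} that contains every edge of I not incident with v and contains no edge of X; in particular, a spanning tree of V \ {v} satisfying these inclusion and exclusion constraints exists. -/
open SimpleGraph Finset

variable {V : Type} [Fintype V] [DecidableEq V]

/-- The edges of a path visiting exactly the vertices other than `v` form a spanning tree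
of the complete graph on `V \ {v}`. -/
theorem isSpanningTreeOff_edges_of_isPath {G : SimpleGraph V} {v a b : V} {p : G.Walk a b}
    (hp : p.IsPath) (hsupp : ∀ u, u ∈ p.support ↔ u ≠ v) :
    IsSpanningTreeOff v p.edges.toFinset := by
  have himage : (p.edges.toFinset : Set (Sym2 V)) = Sym2.map Subtype.val ''
      ((fromEdgeSet {e | e ∈ p.edges}).induce {u | u ≠ v}).edgeSet := by
    ext e
    induction e with
    | _ x y =>
    constructor
    · intro he
      have he' : s(x, y) ∈ p.edges := by simpa using he
      exact ⟨s(⟨x, (hsupp x).1 (p.fst_mem_support_of_mem_edges he')⟩,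
        ⟨y, (hsupp y).1 (p.snd_mem_support_of_mem_edges he')⟩),
        ⟨he', (p.adj_of_mem_edges he').ne⟩, rfl⟩
    · rintro ⟨e, he, hxy⟩
      induction e with
      | _ x' y' =>
      have he' : s(x'.1, y'.1) ∈ p.edges := he.1
      rw [← hxy]
      simpa using he'
  refine ⟨_, isTree_iff_connected_and_card.2 ⟨?_, ?_⟩, himage⟩
  · let q := p.transfer (fromEdgeSet {e | e ∈ p.edges}) fun e he => by
      simpa using ⟨he, G.not_isDiag_of_mem_edgeSet (p.edges_subset_edgeSet he)⟩
    have hq : q.support = p.support := p.support_transfer _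
    rw [connected_iff_exists_forall_reachable]
    refine ⟨⟨a, (hsupp a).1 p.start_mem_support⟩, fun w => ?_⟩
    have hw : w.1 ∈ q.support := hq ▸ (hsupp w).2 w.2
    exact ⟨(q.takeUntil w hw).induce {u | u ≠ v} fun u hu =>
      (hsupp u).1 (hq ▸ q.support_takeUntil_subset_support hw hu)⟩
  · have hedges : Nat.card
        ((fromEdgeSet {e | e ∈ p.edges}).induce {u | u ≠ v}).edgeSet = p.length := by
      rw [Nat.card_coe_set_eq,
        ← Set.ncard_image_of_injective _ (Sym2.map.injective Subtype.val_injective),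
        ← himage, Set.ncard_coe_finset, List.toFinset_card_of_nodup hp.isTrail.edges_nodup,
        Walk.length_edges]
    have hverts : Nat.card {u : V // u ≠ v} = p.support.length := by
      rw [← List.toFinset_card_of_nodup hp.support_nodup]
      exact Nat.subtype_card _ fun u => by simp [hsupp]
    exact (congrArg (· + 1) hedges).trans ((Walk.length_support p).symm.trans hverts.symm)

/-- The edges of a Hamiltonian cycle not incident with its base point form a spanning tree of the
complete graph on the remaining vertices. -/
theorem SimpleGraph.Walk.IsHamiltonianCycle.isSpanningTreeOff_start {G : SimpleGraph V} {v : V}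
    {C : G.Walk v v} (hC : C.IsHamiltonianCycle) :
    IsSpanningTreeOff v (C.edges.toFinset.filter (fun e => v ∉ e)) := by
  have hmem := hC.mem_support
  have hcyc := hC.isCycle
  cases C with
  | nil => exact absurd hcyc Walk.not_isCycle_nil
  | @cons _ w _ h q =>
    obtain ⟨q, rfl⟩ : ∃ q' : G.Walk v w, q = q'.reverse := ⟨q.reverse, by simp⟩
    have hq := (Walk.isPath_reverse_iff q).1 ((Walk.cons_isCycle_iff _ _).1 hcyc).1
    cases q with
    | nil => exact absurd rfl h.ne
    | @cons _ x _ h' p =>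
      obtain ⟨hp, hv⟩ := (Walk.cons_isPath_iff _ _).1 hq
      have hsupp : ∀ u, u ∈ p.support ↔ u ≠ v := by
        refine fun u => ⟨fun hu huv => hv (huv ▸ hu), fun hu => ?_⟩
        have hu' : u ∈ p.support ∨ u = x := by simpa [hu] using hmem u
        exact hu'.elim id fun h => h ▸ p.start_mem_support
      convert isSpanningTreeOff_edges_of_isPath hp hsupp using 1
      ext e
      have hve : e ∈ p.edges → v ∉ e := fun he hve =>
        hv (p.mem_support_of_mem_edges he hve)
      simp only [Walk.edges_cons, Walk.edges_reverse, mem_filter, List.mem_toFinset,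
        List.mem_cons, List.mem_reverse]
      constructor
      · rintro ⟨rfl | rfl | he, hve⟩
        · simp at hve
        · simp at hve
        · exact he
      · exact fun he => ⟨Or.inr (Or.inr he), hve he⟩

theorem stmt13 {V : Type} [Fintype V] [DecidableEq V] (h3 : 3 ≤ Fintype.card V)
    (I X : Finset (Sym2 V))
    (hIedge : (I : Set (Sym2 V)) ⊆ (⊤ : SimpleGraph V).edgeSet)
    (hXedge : (X : Set (Sym2 V)) ⊆ (⊤ : SimpleGraph V).edgeSet)
    (hIX : Disjoint I X)
    (r : V) (H : (⊤ : SimpleGraph V).Walk r r) (hH : H.IsHamiltonianCycle)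
    (hIH : I ⊆ H.edges.toFinset) (hXH : ∀ e ∈ X, e ∉ H.edges.toFinset) (v : V) :
    IsSpanningTreeOff v (H.edges.toFinset.filter (fun e => v ∉ e)) ∧
    (∀ e ∈ I, v ∉ e → e ∈ H.edges.toFinset.filter (fun e => v ∉ e)) ∧
    (∀ e ∈ X, e ∉ H.edges.toFinset.filter (fun e => v ∉ e)) := by
  refine ⟨?_, fun e he hv => mem_filter.2 ⟨hIH he, hv⟩,
    fun e he h => hXH e he (mem_filter.1 h).1⟩
  have hv := hH.mem_support v
  have hedges : H.edges.toFinset = (H.rotate v hv).edges.toFinset :=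
    (List.toFinset_eq_of_perm _ _ (H.rotate_edges v hv).perm).symm
  rw [hedges]
  exact (hH.rotate hv).isSpanningTreeOff_start
end
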